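/- Let a be a non-ultimately-periodic p-automatic sequence whose p-kernel has cardinality s, let f_a(T) = Σ a_i T^{-i} ∈ F_q((T^{-1})), and let P_n, Q_n be the rational approximations built from a prefix U V^ω of a via the Cobham morphism (Q_n(T) = T^{k p^n −1}(T^{ℓ p^n}−1), P_n/Q_n the Laurent expansion of U_n V_n^∞ with U_n = φ(σ^n(U)), V_n = φ(σ^n(V))). Then |f_a − P_n/Q_n| ≥ |Q_n|^{-p^s} for all n. -/

import Mathlib

open Polynomial LaurentSeries
open scoped Classical

/-- The Laurent series `Σ_{i≥0} a_i T^{-i}` associated with a sequence of coefficients,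
where the Hahn-series variable plays the role of `T⁻¹`. -/
noncomputable def fSeq {F : Type*} [Field F] (a : ℕ → F) : LaurentSeries F :=
  (PowerSeries.mk a : PowerSeries F)

/-- The absolute value `|f| = |T|^{-i₀}` on `F((T⁻¹))`; `|0| = 0`, `t = |T| > 1` fixed. -/
noncomputable def lAbs {F : Type*} [Field F] (t : ℝ) (f : LaurentSeries F) : ℝ :=
  if f = 0 then 0 else t ^ (-f.order)

/-- The image of a polynomial `P(T)` in the field of Laurent series in `T⁻¹`. -/
noncomputable def polyLS {F : Type*} [Field F] (P : Polynomial F) : LaurentSeries F :=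
  Polynomial.aeval (HahnSeries.single (-1 : ℤ) (1 : F)) P

/-- The polynomial `P_W(T) = Σ_{j} w_{m-1-j} T^j` of a word with letters in a semiring. -/
noncomputable def Pword {R : Type*} [Semiring R] (W : List R) : Polynomial R :=
  ∑ j ∈ Finset.range W.length, Polynomial.C (W.getD (W.length - 1 - j) 0) * Polynomial.X ^ j

/-- The extension of a substitution `σ` on the alphabet `{0,…,m-1}` to finite words. -/
def applyMorph {m : ℕ} (σ : Fin m → List (Fin m)) (w : List (Fin m)) : List (Fin m) :=
  w.flatMap σ

/-- The `n`-th iterate `σⁿ` of a substitution, as a map on letters. -/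
def iterMorph {m : ℕ} (σ : Fin m → List (Fin m)) : ℕ → Fin m → List (Fin m)
  | 0 => fun i => [i]
  | n + 1 => fun i => applyMorph σ (iterMorph σ n i)

/-- The `p`-kernel of a sequence: all subsequences `(a_{pⁿ i + l})_{i≥0}`, `0 ≤ l < pⁿ`. -/
def pKernel {F : Type*} (p : ℕ) (a : ℕ → F) : Set (ℕ → F) :=
  {c : ℕ → F | ∃ n l : ℕ, l < p ^ n ∧ c = fun i => a (p ^ n * i + l)}

/-- A sequence is ultimately periodic if it is periodic from some index on. -/
def UltimatelyPeriodic {F : Type*} (a : ℕ → F) : Prop :=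
  ∃ N d : ℕ, 0 < d ∧ ∀ n ≥ N, a (n + d) = a n

/-- The section of a sequence. -/
def secSeq {F : Type*} (p l : ℕ) (x : ℕ → F) : ℕ → F := fun i => x (p * i + l)

/-- `x` has period `d` on the window `[r, L)`. -/
def PerOn {F : Type*} (r d L : ℕ) (x : ℕ → F) : Prop :=
  ∀ i, r ≤ i → i + d < L → x (i + d) = x i

/-- `x` has period `d` from index `r` on. -/
def PerAll {F : Type*} (r d : ℕ) (x : ℕ → F) : Prop := ∀ i, r ≤ i → x (i + d) = x i

theorem PerAll.perOn {F : Type*} {r d : ℕ} {x : ℕ → F} (h : PerAll r d x) (L r' : ℕ)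
    (hr : r ≤ r') : PerOn r' d L x := fun i hi _ => h i (hr.trans hi)

theorem PerAll.up {F : Type*} {r d : ℕ} {x : ℕ → F} (h : PerAll r d x) (hd : 1 ≤ d) :
    UltimatelyPeriodic x := ⟨r, d, hd, fun i hi => h i hi⟩

theorem PerOn.mono {F : Type*} {r d L r' L' : ℕ} {x : ℕ → F} (h : PerOn r d L x)
    (hr : r ≤ r') (hL : L' ≤ L) : PerOn r' d L' x :=
  fun i hi hl => h i (hr.trans hi) (hl.trans_le hL)

theorem PerOn.iter {F : Type*} {r d L : ℕ} {x : ℕ → F} (h : PerOn r d L x) (c : ℕ) :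
    PerOn r (c * d) L x := by
  induction c with
  | zero => intro i _ _; simp
  | succ c ih =>
    intro i hi hl
    have e : i + (c + 1) * d = (i + c * d) + d := by ring
    rw [e] at hl ⊢
    rw [h _ (by omega) hl, ih i hi (by omega)]

theorem PerOn.modEq {F : Type*} {r d L : ℕ} {x : ℕ → F} (h : PerOn r d L x) {i j : ℕ}
    (hi : r ≤ i) (hj : r ≤ j) (hiL : i < L) (hjL : j < L) (hij : i ≡ j [MOD d]) : x i = x j := by
  wlog hle : i ≤ j generalizing i j
  · exact (this hj hi hjL hiL hij.symm (by omega)).symm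
  obtain ⟨c, hc⟩ := (Nat.modEq_iff_dvd' hle).1 hij
  have e : j = i + c * d := by rw [mul_comm c d, ← hc]; omega
  subst e
  exact (h.iter c i hi hjL).symm

theorem PerOn.sec {F : Type*} {p r d L r' d' L' c l : ℕ} {x : ℕ → F} (h : PerOn r d L x)
    (hr : r ≤ p * r' + l) (hd : p * d' = c * d) (hl : l < p) (hL : p * L' ≤ L + p - 1 - l) :
    PerOn r' d' L' (secSeq p l x) := by
  intro i hi hil
  have e : p * (i + d') + l = (p * i + l) + c * d := by rw [mul_add, hd]; ring
  unfold secSeq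
  rw [e]
  have h1 : p * r' ≤ p * i := Nat.mul_le_mul_left _ hi
  have h2 : p * (i + d' + 1) ≤ p * L' := Nat.mul_le_mul_left _ hil
  have e2 : p * (i + d' + 1) = p * i + c * d + p := by rw [← hd]; ring
  exact h.iter c _ (by omega) (by omega)

theorem up_of_sec {F : Type*} {p : ℕ} (hp : 2 ≤ p) (x : ℕ → F)
    (h : ∀ l < p, UltimatelyPeriodic (secSeq p l x)) : UltimatelyPeriodic x := by
  have h' : ∀ l, ∃ N d : ℕ, 0 < d ∧ (l < p → ∀ n ≥ N, secSeq p l x (n + d) = secSeq p l x n) := by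
    intro l
    by_cases hl : l < p
    · obtain ⟨N, d, hd, hN⟩ := h l hl
      exact ⟨N, d, hd, fun _ => hN⟩
    · exact ⟨0, 1, one_pos, fun h => absurd h hl⟩
  choose N d hd hN using h'
  refine ⟨p * (∑ l ∈ Finset.range p, N l) + p, p * ∏ l ∈ Finset.range p, d l,
    Nat.mul_pos (by omega) (Finset.prod_pos fun l _ => hd l), ?_⟩
  intro n hn
  have hl : n % p < p := Nat.mod_lt _ (by omega)
  obtain ⟨c, hc⟩ := Finset.dvd_prod_of_mem d (Finset.mem_range.2 hl)
  have hS : N (n % p) ≤ ∑ l ∈ Finset.range p, N l :=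
    Finset.single_le_sum (f := N) (fun _ _ => Nat.zero_le _) (Finset.mem_range.2 hl)
  have hdiv : n = p * (n / p) + n % p := (Nat.div_add_mod n p).symm
  have hge : N (n % p) ≤ n / p := by
    by_contra hcon
    have : p * (n / p) ≤ p * ∑ l ∈ Finset.range p, N l := Nat.mul_le_mul_left _ (by omega)
    omega
  have hall : PerOn (N (n % p)) (d (n % p)) (n / p + c * d (n % p) + 1) (secSeq p (n % p) x) :=
    fun i hi _ => hN _ hl i hi
  have key := hall.iter c (n / p) hge (by omega)
  unfold secSeq at key
  rw [hc]
  have e : n + p * (d (n % p) * c) = p * (n / p + c * d (n % p)) + n % p := by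
    conv_lhs => rw [hdiv]
    simp only [Nat.mul_add_mod, Nat.mod_mod]
    ring
  rw [e, key, ← hdiv]

theorem stable_per {F : Type*} {p r d : ℕ} (hp : 2 ≤ p) (hd : 1 ≤ d) (C : Set (ℕ → F))
    (hC : ∀ x ∈ C, ∀ l < p, secSeq p l x ∈ C)
    (hper : ∀ x ∈ C, PerOn r d (p * (r + d)) x) : ∀ x ∈ C, PerAll r d x := by
  have main : ∀ i, ∀ x ∈ C, r ≤ i → x (i + d) = x i := by
    intro i
    induction i using Nat.strong_induction_on with
    | _ i ih =>
      intro x hx hi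
      by_cases hsm : i + d < p * (r + d)
      · exact hper x hx i hi hsm
      have red : ∀ j, p * (r + d) ≤ j → j ≤ i + d → x j = x (j - p * d) := by
        intro j hj hji
        have hl : j % p < p := Nat.mod_lt _ (by omega)
        have hdm : p * (j / p) + j % p = j := Nat.div_add_mod j p
        have hu : r + d ≤ j / p := (Nat.le_div_iff_mul_le (by omega)).2 (by rw [mul_comm]; exact hj)
        have h2 : 2 * (j / p) ≤ p * (j / p) := Nat.mul_le_mul_right _ hp
        have := ih (j / p - d) (by omega) _ (hC x hx _ hl) (by omega)
        unfold secSeq at this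
        have e1 : p * (j / p - d + d) + j % p = j := by
          rw [Nat.sub_add_cancel (by omega), hdm]
        have e2 : p * (j / p - d) + j % p = j - p * d := by
          have : p * d ≤ p * (j / p) := Nat.mul_le_mul_left _ (by omega)
          rw [Nat.mul_sub]; omega
        rw [e1, e2] at this
        exact this
      have hpd : p * (r + d) = p * r + p * d := by ring
      have hpr : 2 * r ≤ p * r := Nat.mul_le_mul_right _ hp
      have hpd2 : 2 * d ≤ p * d := Nat.mul_le_mul_right _ hp
      rw [red (i + d) (by omega) le_rfl]
      by_cases hi2 : i < p * (r + d)
      · refine (hper x hx).modEq (by omega) hi (by omega) hi2 ?_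
        rw [Nat.modEq_iff_dvd' (by omega)]
        refine ⟨p - 1, ?_⟩
        have : d * (p - 1) + d = p * d := by
          obtain ⟨k, rfl⟩ : ∃ k, p = k + 1 := ⟨p - 1, by omega⟩
          simp; ring
        omega
      · rw [red i (by omega) (by omega)]
        have e : i + d - p * d = i - p * d + d := by omega
        rw [e]
        exact ih (i - p * d) (by omega) x hx (by omega)
  exact fun x hx i hi => main i x hx hi

theorem chain_per {F : Type*} {p r d : ℕ} (hp : 2 ≤ p) (hd : 1 ≤ d) (G : ℕ → Set (ℕ → F))
    (hfin : (G 0).Finite) (hanti : ∀ j, G (j + 1) ⊆ G j)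
    (hsec : ∀ j, ∀ x ∈ G (j + 1), ∀ l < p, secSeq p l x ∈ G j)
    (hper : ∀ x ∈ G 1, PerOn r d (p * (r + d)) x)
    (i m : ℕ) (him : i ≤ m) (hcard : (G i).ncard < (G m).ncard + (m - i)) :
    ∀ x ∈ G m, PerAll r d x := by
  have hA : Antitone G := antitone_nat_of_succ_le hanti
  have hF : ∀ j, (G j).Finite := fun j => hfin.subset (hA (Nat.zero_le j))
  by_cases hst : ∃ j, i ≤ j ∧ j < m ∧ G (j + 1) = G j
  · obtain ⟨j, _, hjm, hj⟩ := hst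
    have := stable_per (r := r) (d := d) hp hd (G (j + 1))
      (fun x hx l hl => by rw [hj]; exact hsec j x hx l hl)
      (fun x hx => hper x (hA (by omega) hx))
    exact fun x hx => this x (hA (by omega) hx)
  · exfalso
    push Not at hst
    have key : ∀ k, i + k ≤ m → (G (i + k)).ncard + k ≤ (G i).ncard := by
      intro k
      induction k with
      | zero => intro _; simp
      | succ k ih =>
        intro hk
        have h1 := ih (by omega)
        have h2 : (G (i + k + 1)).ncard < (G (i + k)).ncard :=
          Set.ncard_lt_ncard ((hanti (i + k)).ssubset_of_ne (hst _ (by omega) (by omega)))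
            (hF _)
        rw [← add_assoc i k 1]
        omega
    have := key (m - i) (by omega)
    rw [Nat.add_sub_cancel' him] at this
    omega

/-- The standard chain. -/
def GK {F : Type*} (p : ℕ) (K : Set (ℕ → F)) (r d j : ℕ) : Set (ℕ → F) :=
  {x | x ∈ K ∧ PerOn r d (p ^ j * (r + d)) x}

theorem GK_chain {F : Type*} {p : ℕ} (hp : 2 ≤ p) (K : Set (ℕ → F)) (hK : K.Finite)
    (hsec : ∀ x ∈ K, ∀ l < p, secSeq p l x ∈ K) (r d : ℕ) (hd : 1 ≤ d)
    (i m : ℕ) (him : i ≤ m) (hcard : (GK p K r d i).ncard < (GK p K r d m).ncard + (m - i)) :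
    ∀ x ∈ GK p K r d m, PerAll r d x := by
  refine chain_per hp hd (GK p K r d) (hK.subset fun x hx => hx.1) ?_ ?_ ?_ i m him hcard
  · intro j x hx
    refine ⟨hx.1, hx.2.mono le_rfl ?_⟩
    exact Nat.mul_le_mul_right _ (Nat.pow_le_pow_right (by omega) (by omega))
  · intro j x hx l hl
    refine ⟨hsec x hx.1 l hl, hx.2.sec (c := p) ?_ rfl hl ?_⟩
    · have := Nat.mul_le_mul_right r hp; omega
    · rw [pow_succ]
      have : p * (p ^ j * (r + d)) = p ^ j * p * (r + d) := by ring
      omega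
  · intro x hx
    simpa using hx.2

/-- Two elements in level `s-1` suffice. -/
theorem GK_two {F : Type*} {p : ℕ} (hp : 2 ≤ p) (K : Set (ℕ → F)) (hK : K.Finite)
    (hsec : ∀ x ∈ K, ∀ l < p, secSeq p l x ∈ K) (s : ℕ) (hs : K.ncard ≤ s)
    (r d : ℕ) (hd : 1 ≤ d) (m : ℕ) (hm : s ≤ m + 1) (x y : ℕ → F) (hxy : x ≠ y)
    (hx : x ∈ GK p K r d m) (hy : y ∈ GK p K r d m) :
    ∀ z ∈ GK p K r d m, PerAll r d z := by
  refine GK_chain hp K hK hsec r d hd 0 m (Nat.zero_le _) ?_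
  have h1 : (GK p K r d 0).ncard ≤ K.ncard := Set.ncard_le_ncard (fun x hx => hx.1) hK
  have h2 : ({x, y} : Set (ℕ → F)).ncard ≤ (GK p K r d m).ncard :=
    Set.ncard_le_ncard (by rintro z (rfl | rfl) <;> assumption) (hK.subset fun x hx => hx.1)
  rw [Set.ncard_pair hxy] at h2
  omega

theorem crt_per {F : Type*} {M d L e δ : ℕ} {x : ℕ → F} (hcop : Nat.Coprime M d)
    (hM : 1 ≤ M) (hd : 1 ≤ d)
    (hL : M * d < L) (he : 1 ≤ e) (heM : e + δ ≤ M) (heM' : e < M) (hx : PerOn 1 d L x)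
    (h : ∀ i, x (M * i + e) = x (M * i + e + δ)) : PerOn 1 δ L x := by
  intro i hi hil
  obtain ⟨j, hj1, hj2⟩ := Nat.chineseRemainder hcop e i
  have hjlt : ∃ j, j < M * d ∧ j ≡ e [MOD M] ∧ j ≡ i [MOD d] := by
    refine ⟨j % (M * d), Nat.mod_lt _ (Nat.mul_pos hM hd), ?_, ?_⟩
    · exact ((Nat.mod_modEq j (M * d)).of_mul_right d).trans hj1
    · exact ((Nat.mod_modEq j (M * d)).of_mul_left M).trans hj2
  obtain ⟨j, hj, hj1, hj2⟩ := hjlt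
  have hmod : j % M = e := by
    rw [hj1, Nat.mod_eq_of_lt heM']
  have hjd : M * (j / M) + e = j := by rw [← hmod]; exact Nat.div_add_mod j M
  have hq : j / M + 1 ≤ d := by
    have : j / M < d := Nat.div_lt_of_lt_mul hj
    omega
  have hq2 : M * (j / M + 1) ≤ M * d := Nat.mul_le_mul_left _ hq
  rw [mul_add] at hq2
  have h1 : x i = x j := hx.modEq hi (by omega) (by omega) (by omega) hj2.symm
  have h2 : x (i + δ) = x (j + δ) :=
    hx.modEq (by omega) (by omega) (by omega) (by omega) (hj2.symm.add_right δ)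
  have h3 := h (j / M)
  rw [hjd] at h3
  rw [h1, h2, h3]

theorem ac_zero {F : Type*} {p : ℕ} (hp : 2 ≤ p) (K : Set (ℕ → F)) (hK : K.Finite)
    (hsec : ∀ x ∈ K, ∀ l < p, secSeq p l x ∈ K) (s : ℕ) (hs : K.ncard ≤ s)
    (d : ℕ) (hd : 1 ≤ d) (x : ℕ → F) (hx : x ∈ K) (h : PerOn 0 d (d * p ^ s) x) :
    PerAll 0 d x := by
  have hxm : x ∈ GK p K 0 d s := ⟨hx, by rw [zero_add, mul_comm]; exact h⟩
  refine GK_chain hp K hK hsec 0 d hd 0 s (Nat.zero_le _) ?_ x hxm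
  have h1 : (GK p K 0 d 0).ncard ≤ K.ncard := Set.ncard_le_ncard (fun x hx => hx.1) hK
  have h2 : 0 < (GK p K 0 d s).ncard :=
    (Set.ncard_pos (hK.subset fun x hx => hx.1)).2 ⟨x, hxm⟩
  omega

theorem block_eq {F : Type*} {p : ℕ} (hp : 2 ≤ p) {x : ℕ → F}
    (heq : ∀ l < p, secSeq p l x = secSeq p 0 x) {i j : ℕ} (h : i / p = j / p) : x i = x j := by
  have key : ∀ i, x i = x (p * (i / p)) := by
    intro i
    have := congrFun (heq (i % p) (Nat.mod_lt _ (by omega))) (i / p)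
    simp only [secSeq, Nat.div_add_mod, add_zero] at this
    exact this
  rw [key i, key j, h]

/-- Consecutive indices in the same block. -/
theorem div_pred_eq {p i : ℕ} (hp : 2 ≤ p) (h : ¬ p ∣ i + 1) : (i + 1) / p = i / p := by
  rw [Nat.succ_div_of_not_dvd h]

theorem core_equal {F : Type*} {p : ℕ} (hp : p.Prime) (K : Set (ℕ → F)) (hK : K.Finite)
    (hsec : ∀ x ∈ K, ∀ l < p, secSeq p l x ∈ K) (s : ℕ) (hs : K.ncard ≤ s)
    (r d : ℕ) (hr : 1 ≤ r) (hd : 1 ≤ d)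
    (ih : ∀ r' d' : ℕ, ∀ y ∈ K, 1 ≤ r' → 1 ≤ d' → r' + d' < r + d →
      PerOn r' d' ((r' + d' - 1) * p ^ s + 1) y → UltimatelyPeriodic y)
    (x : ℕ → F) (hx : x ∈ K) (h : PerOn r d ((r + d - 1) * p ^ s + 1) x)
    (heq : ∀ l < p, secSeq p l x = secSeq p 0 x) : UltimatelyPeriodic x := by
  have hp2 := hp.two_le
  have hs1 : 1 ≤ s := by
    have : 0 < K.ncard := (Set.ncard_pos hK).2 ⟨x, hx⟩
    omega
  have hQ : 2 ≤ p ^ s := hp2.trans (Nat.le_self_pow (by omega) p)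
  have hc : secSeq p 0 x ∈ K := hsec x hx 0 (by omega)
  have fin : UltimatelyPeriodic (secSeq p 0 x) → UltimatelyPeriodic x := fun hu =>
    up_of_sec hp2 x fun l hl => by rw [heq l hl]; exact hu
  obtain ⟨r0, rfl⟩ : ∃ r0, r = r0 + 1 := ⟨r - 1, by omega⟩
  have hN : r0 + 1 + d - 1 = r0 + d := by omega
  rw [hN] at h
  -- lowering the preperiod
  have lower : x r0 = x (r0 + d) → UltimatelyPeriodic x := by
    intro h0
    have hP : PerOn r0 d ((r0 + d) * p ^ s + 1) x := by
      intro i hi hil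
      rcases hi.eq_or_lt with rfl | hlt
      · exact h0.symm
      · exact h i hlt hil
    rcases Nat.eq_zero_or_pos r0 with rfl | hr0
    · refine (ac_zero hp2 K hK hsec s hs d hd x hx (hP.mono le_rfl ?_)).up hd
      simp
    · refine ih r0 d x hx hr0 hd (by omega) (hP.mono le_rfl ?_)
      have : (r0 + d - 1) * p ^ s ≤ (r0 + d) * p ^ s := Nat.mul_le_mul_right _ (by omega)
      omega
  have hbig : 2 * (r0 + d) ≤ (r0 + d) * p ^ s := by nlinarith
  by_cases hpd : p ∣ d
  · by_cases hpr : p ∣ r0 + 1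
    · obtain ⟨d', rfl⟩ := hpd
      obtain ⟨r', hr'⟩ := hpr
      have hd' : 1 ≤ d' := Nat.pos_of_ne_zero (by rintro rfl; simp at hd)
      have hr'1 : 1 ≤ r' := Nat.pos_of_ne_zero (by rintro rfl; simp at hr')
      refine fin (ih r' d' _ hc hr'1 hd' (by nlinarith) (h.sec (c := 1) (by omega) (by ring) (by omega) ?_))
      obtain ⟨w, hw⟩ : ∃ w, r' + d' = w + 1 := ⟨r' + d' - 1, by omega⟩
      have e1 : r0 + p * d' + 1 = p * (w + 1) := by rw [← hw, mul_add, ← hr']; ring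
      have e2 : p * w ≤ r0 + p * d' := by rw [mul_add] at e1; omega
      have e3 : p * w * p ^ s ≤ (r0 + p * d') * p ^ s := Nat.mul_le_mul_right _ e2
      have e4 : p * ((r' + d' - 1) * p ^ s + 1) = p * w * p ^ s + p := by
        rw [hw]; simp; ring
      omega
    · apply lower
      have h1 : x (r0 + 1) = x r0 := block_eq hp2 heq (div_pred_eq hp2 hpr)
      have h2 : x (r0 + d + 1) = x (r0 + d) := by
        refine block_eq hp2 heq (div_pred_eq hp2 fun hdv => hpr ?_)
        have : r0 + d + 1 = r0 + 1 + d := by ring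
        rw [this] at hdv
        exact (Nat.dvd_add_left hpd).1 hdv
      have h3 := h (r0 + 1) le_rfl (by omega)
      rw [show r0 + 1 + d = r0 + d + 1 by ring] at h3
      rw [← h1, ← h2, h3]
  · rcases hd.eq_or_lt with hd1 | hd2
    · subst hd1
      by_cases hpr : p ∣ r0 + 1
      · obtain ⟨r', hr'⟩ := hpr
        have hr'1 : 1 ≤ r' := Nat.pos_of_ne_zero (by rintro rfl; simp at hr')
        refine fin (ih r' 1 _ hc hr'1 le_rfl (by nlinarith) (h.sec (c := p) (by omega) rfl (by omega) ?_))
        have e4 : p * ((r' + 1 - 1) * p ^ s + 1) = (r0 + 1) * p ^ s + p := by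
          rw [hr']; simp; ring
        omega
      · exact lower (block_eq hp2 heq (div_pred_eq hp2 hpr)).symm
    · refine ih (r0 + 1) 1 x hx (by omega) le_rfl (by omega) ?_
      intro i hi hil
      have hsz : i + 1 + d < (r0 + d) * p ^ s + 1 := by
        have e : (r0 + 1 + 1 - 1) * p ^ s = (r0 + 1) * p ^ s := by simp
        rw [e] at hil
        obtain ⟨w, rfl⟩ : ∃ w, d = w + 1 := ⟨d - 1, by omega⟩
        have : (r0 + (w + 1)) * p ^ s = (r0 + 1) * p ^ s + w * p ^ s := by ring
        have : w * 2 ≤ w * p ^ s := Nat.mul_le_mul_left _ hQ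
        omega
      by_cases hdv : p ∣ i + 1
      · have h1 := h i hi (by omega)
        have h2 := h (i + 1) (by omega) hsz
        rw [← h1, ← h2, show i + 1 + d = i + d + 1 by ring]
        refine block_eq hp2 heq (div_pred_eq hp2 fun hdv2 => hpd ?_)
        rw [show i + d + 1 = i + 1 + d by ring] at hdv2
        exact (Nat.dvd_add_right hdv).1 hdv2
      · exact block_eq hp2 heq (div_pred_eq hp2 hdv)

theorem core_one {F : Type*} {p : ℕ} (hp : p.Prime) (K : Set (ℕ → F)) (hK : K.Finite)
    (hsec : ∀ x ∈ K, ∀ l < p, secSeq p l x ∈ K) (s : ℕ) (hs : K.ncard ≤ s)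
    (d : ℕ) (hd : 1 ≤ d) (hpd : ¬ p ∣ d)
    (ih : ∀ r' d' : ℕ, ∀ y ∈ K, 1 ≤ r' → 1 ≤ d' → r' + d' < 1 + d →
      PerOn r' d' ((r' + d' - 1) * p ^ s + 1) y → UltimatelyPeriodic y)
    (x : ℕ → F) (hx : x ∈ K) (h : PerOn 1 d (d * p ^ s + 1) x)
    (hne : ¬ ∀ l < p, secSeq p l x = secSeq p 0 x) : UltimatelyPeriodic x := by
  by_contra hup
  have hp2 := hp.two_le
  have hs2 : 2 ≤ s := by
    push Not at hne
    obtain ⟨l, hl, hne⟩ := hne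
    have h2 : ({secSeq p l x, secSeq p 0 x} : Set (ℕ → F)).ncard ≤ K.ncard :=
      Set.ncard_le_ncard (by
        rintro z (rfl | rfl)
        · exact hsec x hx l hl
        · exact hsec x hx 0 (by omega)) hK
    rw [Set.ncard_pair hne] at h2
    omega
  obtain ⟨u, rfl⟩ : ∃ u, s = u + 2 := ⟨s - 2, by omega⟩
  have hQ1 : 1 ≤ p ^ u := Nat.one_le_pow _ _ (by omega)
  have hdp : d ≤ d * p ^ u := Nat.le_mul_of_pos_right _ hQ1
  have hLe : d * p ^ (u + 2) = p * (p * (d * p ^ u)) := by ring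
  have hLd : p * (p * d) ≤ d * p ^ (u + 2) := by
    rw [hLe]; exact Nat.mul_le_mul_left _ (Nat.mul_le_mul_left _ hdp)
  have hpd' : 2 * d ≤ p * d := Nat.mul_le_mul_right _ hp2
  have hppd' : 2 * (p * d) ≤ p * (p * d) := Nat.mul_le_mul_right _ hp2
  -- the value at zero differs
  have h0 : x 0 ≠ x d := by
    intro h0
    refine hup ((ac_zero hp2 K hK hsec _ hs d hd x hx ?_).up hd)
    intro i hi hil
    rcases Nat.eq_zero_or_pos i with rfl | hi
    · rw [zero_add]; exact h0.symm
    · exact h i hi (by omega)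
  -- periodic sections are excluded
  have hxG : x ∈ GK p K 1 d (u + 1) := by
    refine ⟨hx, h.mono le_rfl ?_⟩
    have : p ^ (u + 1) * (1 + d) ≤ p ^ (u + 1) * (p * d) :=
      Nat.mul_le_mul_left _ (by omega)
    have e : p ^ (u + 1) * (p * d) = d * p ^ (u + 2) := by ring
    omega
  have hnoper : ∀ y ∈ K, PerAll 0 d y → False := by
    intro y hy hper
    have hyG : y ∈ GK p K 1 d (u + 1) := ⟨hy, hper.perOn _ _ (by omega)⟩
    by_cases hxy : x = y
    · exact hup (hxy ▸ hper.up hd)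
    · exact hup ((GK_two hp2 K hK hsec _ hs 1 d hd (u + 1) le_rfl x y hxy hxG hyG x hxG).up hd)
  have hsecG : ∀ l, 1 ≤ l → l < p → secSeq p l x ∈ GK p K 0 d (u + 1) := by
    intro l hl1 hl
    refine ⟨hsec x hx l hl, h.sec (c := p) (by omega) rfl hl ?_⟩
    have : p * (p ^ (u + 1) * (0 + d)) = d * p ^ (u + 2) := by ring
    omega
  have hc := hsecG 1 le_rfl (by omega)
  have hGf : ∀ j, (GK p K 0 d j).Finite := fun j => hK.subset fun x hx => hx.1
  -- all sections at nonzero digits are equal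
  have hsame : ∀ l, 1 ≤ l → l < p → secSeq p l x = secSeq p 1 x := by
    intro l hl1 hl
    by_contra hcon
    exact hnoper _ hc.1 (GK_two hp2 K hK hsec _ hs 0 d hd (u + 1) le_rfl _ _ hcon
      (hsecG l hl1 hl) hc _ hc)
  have hlev1 : u + 1 ≤ (GK p K 0 d 1).ncard := by
    by_contra hcon
    have h2 : 0 < (GK p K 0 d (u + 1)).ncard := (Set.ncard_pos (hGf _)).2 ⟨_, hc⟩
    exact hnoper _ hc.1 (GK_chain hp2 K hK hsec 0 d hd 1 (u + 1) (by omega) (by omega) _ hc)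
  have hlev2 : (GK p K 0 d u).ncard ≤ 2 := by
    by_contra hcon
    have h1 : (GK p K 0 d 0).ncard ≤ K.ncard := Set.ncard_le_ncard (fun x hx => hx.1) hK
    have hcu : secSeq p 1 x ∈ GK p K 0 d u := by
      refine ⟨hc.1, hc.2.mono le_rfl ?_⟩
      exact Nat.mul_le_mul_right _ (Nat.pow_le_pow_right (by omega) (by omega))
    exact hnoper _ hc.1 (GK_chain hp2 K hK hsec 0 d hd 0 u (by omega) (by omega) _ hcu)
  have hnot1 : ∀ y : ℕ → F, y 0 ≠ y d → y ∉ GK p K 0 d 1 := by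
    intro y hy hmem
    have := hmem.2 0 le_rfl (by rw [pow_one, zero_add]; omega)
    rw [zero_add] at this
    exact hy this.symm
  have hzero : secSeq p 0 x = x := by
    by_contra hcon
    have hz : secSeq p 0 x 0 ≠ secSeq p 0 x d := by
      have : x (p * d) = x d := h.modEq (by omega) hd (by omega) (by omega) (by simp [Nat.ModEq])
      simp only [secSeq, mul_zero, add_zero, this]
      exact h0
    have hdis : ({secSeq p 0 x, x} : Set (ℕ → F)) ∩ GK p K 0 d 1 = ∅ := by
      ext z
      simp only [Set.mem_inter_iff, Set.mem_insert_iff, Set.mem_singleton_iff, Set.mem_empty_iff_false,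
        iff_false, not_and]
      rintro (rfl | rfl)
      · exact hnot1 _ hz
      · exact hnot1 _ h0
    have hun : (({secSeq p 0 x, x} : Set (ℕ → F)) ∪ GK p K 0 d 1).ncard ≤ K.ncard := by
      refine Set.ncard_le_ncard ?_ hK
      rintro z ((rfl | rfl) | hz)
      · exact hsec x hx 0 (by omega)
      · exact hx
      · exact hz.1
    rw [Set.ncard_union_eq (Set.disjoint_iff_inter_eq_empty.2 hdis) (Set.toFinite _) (hGf 1),
      Set.ncard_pair hcon] at hun
    omega
  rcases hd.eq_or_lt with hd1 | hd2
  · -- period one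
    subst hd1
    let G : ℕ → Set (ℕ → F) := fun j => {y | y ∈ K ∧ ∀ i < p ^ j, y i = x 1}
    have hGK : ∀ j, G j ⊆ K := fun j y hy => hy.1
    have hval : ∀ i, 1 ≤ i → i < 1 * p ^ (u + 2) + 1 → x i = x 1 := fun i hi hil =>
      h.modEq hi le_rfl hil (by omega) (Nat.modEq_one)
    have hcG : secSeq p 1 x ∈ G (u + 1) := by
      refine ⟨hc.1, fun i hi => hval _ (by omega) ?_⟩
      have : p * (i + 1) ≤ p * p ^ (u + 1) := Nat.mul_le_mul_left _ hi
      have e : p * p ^ (u + 1) = 1 * p ^ (u + 2) := by ring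
      rw [mul_add] at this
      omega
    refine hnoper _ hc.1 (chain_per (r := 0) (d := 1) hp2 le_rfl G (hK.subset (hGK 0)) ?_ ?_ ?_ 0 (u + 1)
      (Nat.zero_le _) ?_ _ hcG)
    · intro j y hy
      exact ⟨hy.1, fun i hi => hy.2 i (hi.trans_le (Nat.pow_le_pow_right (by omega) (by omega)))⟩
    · intro j y hy l hl
      refine ⟨hsec y hy.1 l hl, fun i hi => hy.2 _ ?_⟩
      have : p * (i + 1) ≤ p * p ^ j := Nat.mul_le_mul_left _ hi
      rw [pow_succ, mul_comm (p ^ j) p]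
      rw [mul_add] at this
      omega
    · intro y hy i _ hil
      have hil' : i + 1 < p ^ 1 := by simpa using hil
      rw [hy.2 _ hil', hy.2 _ (by omega)]
    · have h2 : 0 < (G (u + 1)).ncard :=
        (Set.ncard_pos (hK.subset (hGK _))).2 ⟨_, hcG⟩
      have h1 : (G 0).ncard < K.ncard := by
        refine Set.ncard_lt_ncard ((hGK 0).ssubset_of_ne ?_) hK
        intro hG
        rw [← hG] at hx
        exact h0 (hx.2 0 (by simp))
      omega
  · by_cases hp3 : 3 ≤ p
    · have hP : PerOn 1 1 (d * p ^ (u + 2) + 1) x := by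
        refine crt_per (M := p) (e := 1) ((Nat.Prime.coprime_iff_not_dvd hp).2 hpd) (by omega) hd
          (by omega) le_rfl (by omega) (by omega) h ?_
        intro i
        exact (congrFun (hsame 2 (by omega) (by omega)) i).symm
      refine hup (ih 1 1 x hx le_rfl le_rfl (by omega) (hP.mono le_rfl ?_))
      have := Nat.mul_le_mul_right (p ^ (u + 2)) hd
      simp only [Nat.add_sub_cancel]
      omega
    · have hp2' : p = 2 := by omega
      subst hp2'
      have hd3 : 3 ≤ d := by
        by_contra hcon
        exact hpd ⟨1, by omega⟩
      have hcop : Nat.Coprime 4 d := by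
        have : Nat.Coprime 2 d := (Nat.Prime.coprime_iff_not_dvd hp).2 hpd
        exact Nat.Coprime.pow_left 2 this
      have hdbl : ∀ i, x (2 * i) = x i := fun i => congrFun hzero i
      have red : ∀ δ e, 1 ≤ δ → δ ≤ 2 → 1 ≤ e → e < 4 → e + δ ≤ 4 →
          (∀ i, x (4 * i + e) = x (4 * i + e + δ)) → False := by
        intro δ e h1 h2 h3 h4 h5 h6
        have hP : PerOn 1 δ (d * 2 ^ (u + 2) + 1) x :=
          crt_per hcop (by omega) hd (by omega) h3 h5 h4 h h6
        refine hup (ih 1 δ x hx le_rfl h1 (by omega) (hP.mono le_rfl ?_))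
        have := Nat.mul_le_mul_right (2 ^ (u + 2)) (show 1 + δ - 1 ≤ d by omega)
        omega
      have hsec2 : ∀ l < 2, secSeq 2 l (secSeq 2 1 x) ∈ GK 2 K 0 d u := by
        intro l hl
        refine ⟨hsec _ hc.1 l hl, hc.2.sec (c := 2) (by omega) rfl hl ?_⟩
        have : 2 * (2 ^ u * (0 + d)) = 2 ^ (u + 1) * (0 + d) := by ring
        omega
      have hcu : secSeq 2 1 x ∈ GK 2 K 0 d u := by
        refine ⟨hc.1, hc.2.mono le_rfl ?_⟩
        exact Nat.mul_le_mul_right _ (Nat.pow_le_pow_right (by omega) (by omega))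
      have hA : secSeq 2 0 (secSeq 2 1 x) ≠ secSeq 2 1 x := by
        intro hcon
        refine red 1 1 (by omega) (by omega) (by omega) (by omega) (by omega) fun i => ?_
        have := congrFun hcon i
        simp only [secSeq] at this
        rw [← hdbl (2 * i + 1)] at this
        convert this using 2 <;> ring
      have hB : secSeq 2 0 (secSeq 2 1 x) ≠ secSeq 2 1 (secSeq 2 1 x) := by
        intro hcon
        refine red 2 1 (by omega) (by omega) (by omega) (by omega) (by omega) fun i => ?_
        have := congrFun hcon i
        simp only [secSeq] at this
        convert this using 2 <;> ring
      have hC : secSeq 2 1 x ≠ secSeq 2 1 (secSeq 2 1 x) := by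
        intro hcon
        refine red 1 2 (by omega) (by omega) (by omega) (by omega) (by omega) fun i => ?_
        have := congrFun hcon i
        simp only [secSeq] at this
        rw [← hdbl (2 * i + 1)] at this
        convert this using 2 <;> ring
      have h3 : ({secSeq 2 0 (secSeq 2 1 x), secSeq 2 1 x, secSeq 2 1 (secSeq 2 1 x)} :
          Set (ℕ → F)).ncard = 3 := Set.ncard_eq_three.2 ⟨_, _, _, hA, hB, hC, rfl⟩
      have h4 := Set.ncard_le_ncard (s := {secSeq 2 0 (secSeq 2 1 x), secSeq 2 1 x,
        secSeq 2 1 (secSeq 2 1 x)}) (t := GK 2 K 0 d u) (by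
          rintro z (rfl | rfl | rfl)
          · exact hsec2 0 (by omega)
          · exact hcu
          · exact hsec2 1 (by omega)) (hGf u)
      omega

theorem core {F : Type*} {p : ℕ} (hp : p.Prime) (K : Set (ℕ → F)) (hK : K.Finite)
    (hsec : ∀ x ∈ K, ∀ l < p, secSeq p l x ∈ K) (s : ℕ) (hs : K.ncard ≤ s) :
    ∀ N r d : ℕ, r + d = N → ∀ x ∈ K, 1 ≤ r → 1 ≤ d →
      PerOn r d ((r + d - 1) * p ^ s + 1) x → UltimatelyPeriodic x := by
  intro N
  induction N using Nat.strong_induction_on with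
  | _ N ih0 =>
    intro r d hN x hx hr hd h
    have hp2 := hp.two_le
    have ih : ∀ r' d' : ℕ, ∀ y ∈ K, 1 ≤ r' → 1 ≤ d' → r' + d' < r + d →
        PerOn r' d' ((r' + d' - 1) * p ^ s + 1) y → UltimatelyPeriodic y :=
      fun r' d' y hy h1 h2 h3 h4 => ih0 (r' + d') (by omega) r' d' rfl y hy h1 h2 h4
    by_cases heq : ∀ l < p, secSeq p l x = secSeq p 0 x
    · exact core_equal hp K hK hsec s hs r d hr hd ih x hx h heq
    have hs1 : 1 ≤ s := by
      have : 0 < K.ncard := (Set.ncard_pos hK).2 ⟨x, hx⟩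
      omega
    obtain ⟨u, rfl⟩ : ∃ u, s = u + 1 := ⟨s - 1, by omega⟩
    -- a general way to finish
    have fin : ∀ r' d', 1 ≤ d' → r' + d' ≤ r + d - 1 →
        (∀ l < p, secSeq p l x ∈ GK p K r' d' u) → UltimatelyPeriodic x := by
      intro r' d' hd' _ hmem
      have heq' := heq
      push Not at heq'
      obtain ⟨l, hl, hne⟩ := heq'
      have := GK_two hp2 K hK hsec _ hs r' d' hd' u le_rfl _ _ hne (hmem l hl) (hmem 0 (by omega))
      exact up_of_sec hp2 x fun l hl => (this _ (hmem l hl)).up hd'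
    have size : ∀ r' d' l, l < p → r' + d' ≤ r + d - 1 →
        p * (p ^ u * (r' + d')) ≤ (r + d - 1) * p ^ (u + 1) + 1 + p - 1 - l := by
      intro r' d' l hl hle
      have e : p * (p ^ u * (r' + d')) = (r' + d') * p ^ (u + 1) := by ring
      have := Nat.mul_le_mul_right (p ^ (u + 1)) hle
      omega
    by_cases hpd : p ∣ d
    · obtain ⟨d', rfl⟩ := hpd
      have hd' : 1 ≤ d' := Nat.pos_of_ne_zero (by rintro rfl; simp at hd)
      have hlt : 2 * d' ≤ p * d' := Nat.mul_le_mul_right _ hp2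
      have hrr : 2 * r ≤ p * r := Nat.mul_le_mul_right _ hp2
      refine fin r d' hd' (by omega) fun l hl => ⟨hsec x hx l hl, ?_⟩
      exact h.sec (c := 1) (by omega) (by ring) hl (size r d' l hl (by omega))
    · rcases hr.eq_or_lt with hr1 | hr2
      · subst hr1
        exact core_one hp K hK hsec _ hs d hd hpd ih x hx (by simpa using h) heq
      · have hrr : 2 * (r - 1) ≤ p * (r - 1) := Nat.mul_le_mul_right _ hp2
        refine fin (r - 1) d hd (by omega) fun l hl => ⟨hsec x hx l hl, ?_⟩
        exact h.sec (c := p) (by omega) rfl hl (size (r - 1) d l hl (by omega))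

theorem coeff_single_mul' {F : Type*} [Field F] (b i : ℤ) (g : LaurentSeries F) :
    (HahnSeries.single b (1 : F) * g).coeff i = g.coeff (i - b) := by
  have := HahnSeries.coeff_single_mul_add (r := (1 : F)) (x := g) (a := i - b) (b := b)
  rw [sub_add_cancel, one_mul] at this
  exact this

theorem polyLS_X_pow {F : Type*} [Field F] (m : ℕ) :
    polyLS (Polynomial.X ^ m : Polynomial F) = HahnSeries.single (-(m : ℤ)) (1 : F) := by
  simp [polyLS, HahnSeries.single_pow]

theorem polyLS_coeff_pos {F : Type*} [Field F] (P : Polynomial F) (i : ℤ) (hi : 0 < i) :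
    (polyLS P).coeff i = 0 := by
  induction P using Polynomial.induction_on' with
  | add P Q hP hQ =>
    have : polyLS (P + Q) = polyLS P + polyLS Q := by simp [polyLS]
    rw [this, HahnSeries.coeff_add, hP, hQ, add_zero]
  | monomial m c =>
    have : polyLS (Polynomial.monomial m c) = HahnSeries.single (-(m : ℤ)) c := by
      have hc : (algebraMap F (LaurentSeries F)) c = HahnSeries.single (0 : ℤ) c := by
        rw [HahnSeries.algebraMap_apply', PowerSeries.algebraMap_apply, HahnSeries.ofPowerSeries_C]
        rfl
      rw [polyLS, Polynomial.aeval_monomial, HahnSeries.single_pow, hc,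
        HahnSeries.single_mul_single]
      simp
    rw [this, HahnSeries.coeff_single_of_ne (by omega)]

theorem pKernel_sec {F : Type*} (p : ℕ) (a : ℕ → F) :
    ∀ x ∈ pKernel p a, ∀ l < p, secSeq p l x ∈ pKernel p a := by
  rintro x ⟨n, l, hl, rfl⟩ l' hl'
  refine ⟨n + 1, p ^ n * l' + l, ?_, ?_⟩
  · have : p ^ n * (l' + 1) ≤ p ^ n * p := Nat.mul_le_mul_left _ hl'
    rw [mul_add] at this
    rw [pow_succ]
    omega
  · funext i
    simp only [secSeq]
    congr 1
    ring

theorem bound_of_core (p : ℕ) (hp : p.Prime) {F : Type*} [Field F]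
    (t : ℝ) (ht : 1 < t)
    (a : ℕ → F) (hnup : ¬ UltimatelyPeriodic a)
    (s : ℕ) (hfin : (pKernel p a).Finite) (hs : (pKernel p a).ncard = s)
    (r0 d : ℕ) (hd : 1 ≤ d) (P Q : Polynomial F)
    (hQ : Q = Polynomial.X ^ r0 * (Polynomial.X ^ d - 1)) :
    lAbs t (polyLS Q) ^ (-(p ^ s : ℤ)) ≤ lAbs t (fSeq a - polyLS P / polyLS Q) := by
  have hQs : polyLS Q = HahnSeries.single (-((r0 + d : ℕ) : ℤ)) (1 : F)
      - HahnSeries.single (-(r0 : ℤ)) (1 : F) := by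
    rw [← polyLS_X_pow, ← polyLS_X_pow, polyLS, polyLS, polyLS, ← map_sub, hQ, pow_add]
    congr 1
    ring
  have hQc : (polyLS Q).coeff (-((r0 + d : ℕ) : ℤ)) ≠ 0 := by
    rw [hQs, HahnSeries.coeff_sub, HahnSeries.coeff_single_same,
      HahnSeries.coeff_single_of_ne (by omega)]
    simp
  have hQ0 : polyLS Q ≠ 0 := HahnSeries.ne_zero_of_coeff_ne_zero hQc
  have hQo : (polyLS Q).order ≤ -((r0 + d : ℕ) : ℤ) := HahnSeries.order_le_of_coeff_ne_zero hQc
  set g := polyLS P / polyLS Q with hg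
  have hgQ : polyLS Q * g = polyLS P := by rw [hg]; field_simp
  have hgper : ∀ j : ℕ, r0 + 1 ≤ j → g.coeff ((j + d : ℕ) : ℤ) = g.coeff (j : ℤ) := by
    intro j hj
    have h1 := polyLS_coeff_pos P ((j : ℤ) - r0) (by omega)
    rw [← hgQ, hQs, sub_mul, HahnSeries.coeff_sub, coeff_single_mul', coeff_single_mul',
      sub_eq_zero] at h1
    convert h1 using 2
    · push_cast; ring
    · ring
  have main : ∃ i : ℕ, i ≤ (r0 + d) * p ^ s ∧ (fSeq a - g).coeff (i : ℤ) ≠ 0 := by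
    by_contra hcon
    push Not at hcon
    have hag : ∀ i : ℕ, i ≤ (r0 + d) * p ^ s → a i = g.coeff (i : ℤ) := by
      intro i hi
      have := hcon i hi
      rw [HahnSeries.coeff_sub, sub_eq_zero, fSeq, LaurentSeries.coeff_coe_powerSeries,
        PowerSeries.coeff_mk] at this
      exact this
    refine hnup (core hp (pKernel p a) hfin (pKernel_sec p a) s hs.le _ (r0 + 1) d rfl a
      ⟨0, 0, by simp, by simp⟩ (by omega) hd ?_)
    intro i hi hil
    have e : r0 + 1 + d - 1 = r0 + d := by omega
    rw [e] at hil
    rw [hag _ (by omega), hag i (by omega), hgper i hi]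
  obtain ⟨i, hi, hne⟩ := main
  have hh0 : fSeq a - g ≠ 0 := HahnSeries.ne_zero_of_coeff_ne_zero hne
  have hho : (fSeq a - g).order ≤ (i : ℤ) := HahnSeries.order_le_of_coeff_ne_zero hne
  rw [lAbs, lAbs, if_neg hQ0, if_neg hh0, ← zpow_mul]
  apply zpow_le_zpow_right₀ ht.le
  have h1 : (i : ℤ) ≤ ((r0 + d : ℕ) : ℤ) * (p : ℤ) ^ s := by exact_mod_cast hi
  have h2 : ((r0 + d : ℕ) : ℤ) * (p : ℤ) ^ s ≤ (-(polyLS Q).order) * (p : ℤ) ^ s :=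
    mul_le_mul_of_nonneg_right (by omega) (by positivity)
  have h3 : -(polyLS Q).order * -((p : ℤ) ^ s) = -((-(polyLS Q).order) * (p : ℤ) ^ s) := by ring
  rw [h3]
  omega

/-- For a non-ultimately-periodic `p`-automatic sequence `a = φ(σ^∞(b₀))` whose
`p`-kernel has cardinality `s`, the rational approximations `P_n/Q_n` obtained from a
prefix `U V^ω` (`ω = 1 + 1/ℓ`) of the fixed point satisfy
`|f_a - P_n/Q_n| ≥ |Q_n|^{-pˢ}` for every `n`. -/
theorem lower_bound_kernel
    (p e q : ℕ) (hp : p.Prime) (he : 1 ≤ e) (hq : q = p ^ e)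
    (F : Type*) [Field F] [Fintype F] (hcard : Fintype.card F = q)
    (t : ℝ) (ht : 1 < t)
    (a : ℕ → F) (hnup : ¬ UltimatelyPeriodic a)
    (s : ℕ) (hfin : (pKernel p a).Finite) (hs : (pKernel p a).ncard = s)
    (m : ℕ) (σ : Fin m → List (Fin m)) (hσ : ∀ i, (σ i).length = p)
    (φ : Fin m → F) (b : ℕ → Fin m)
    (hfix : ∀ i : ℕ, ∀ j < p, b (p * i + j) = (σ (b i)).getD j (b i))
    (ha : a = fun i => φ (b i))
    (U V : List (Fin m)) (k ℓ : ℕ) (hk : k = U.length) (hℓ : ℓ = V.length) (hℓ1 : 1 ≤ ℓ)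
    (hprefix : ∀ (i : ℕ) (h : i < (U ++ V ++ V.take 1).length),
      (U ++ V ++ V.take 1)[i] = b i)
    (n : ℕ)
    (Un Vn : List F)
    (hUn : Un = (U.flatMap (iterMorph σ n)).map φ)
    (hVn : Vn = (V.flatMap (iterMorph σ n)).map φ)
    (Pn Qn : Polynomial F)
    (hPn : Pn = Pword Un * (Polynomial.X ^ (ℓ * p ^ n) - 1) + Pword Vn)
    (hQn : Qn = Polynomial.X ^ (k * p ^ n - 1) * (Polynomial.X ^ (ℓ * p ^ n) - 1)) :
    lAbs t (polyLS Qn) ^ (-(p ^ s : ℤ)) ≤ lAbs t (fSeq a - polyLS Pn / polyLS Qn) := by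
  have hp2 := hp.two_le
  have hpn : 1 ≤ p ^ n := Nat.one_le_pow _ _ (by omega)
  have hd : 1 ≤ ℓ * p ^ n := Nat.mul_pos hℓ1 hpn
  exact bound_of_core p hp t ht a hnup s hfin hs (k * p ^ n - 1) (ℓ * p ^ n) hd Pn Qn hQn
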